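/- (Existence of Shintani domains) Let F be a totally real number field of degree n and f a nonzero integral ideal of 𝒪_F. Then there exist a finite index set J and, for each j ∈ J, an ℝ-linearly independent tuple v_j = (v_{j,1}, …, v_{j,r_j}) of totally positive elements of 𝒪_F, such that the open simplicial cones C(v_j) ⊆ X are pairwise disjoint and the totally positive orthant X is the disjoint union X = ⨆_{ε ∈ E_{f,+}} ε · (⨆_{j ∈ J} C(v_j)); i.e., D := ⨆_{j ∈ J} C(v_j) is a fundamental domain for the multiplication action of E_{f,+} on X. -/

import Mathlib

open NumberField

/-- A number field is totally real if every complex embedding takes real values. -/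
def IsTotallyRealField (F : Type*) [Field F] : Prop :=
  ∀ φ : F →+* ℂ, ∀ x : F, (φ x).im = 0

/-- The totally positive orthant of `F ⊗ ℝ`, identified with `ℝ^{Hom(F,ℝ)}`. -/
def posOrthant (F : Type*) [Field F] : Set ((F →+* ℝ) → ℝ) :=
  {y | ∀ σ : F →+* ℝ, 0 < y σ}

/-- The open simplicial cone generated by `v_1, …, v_r ∈ F` inside `ℝ^{Hom(F,ℝ)}`. -/
def simplicialCone {F : Type*} [Field F] {r : ℕ} (v : Fin r → F) :
    Set ((F →+* ℝ) → ℝ) :=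
  {y | ∃ t : Fin r → ℝ, (∀ i, 0 < t i) ∧ y = fun σ => ∑ i, t i * σ (v i)}

/-- The multiplication action of `α ∈ F^×` on subsets of `ℝ^{Hom(F,ℝ)}`:
`(α · y)_σ = σ(α) y_σ`. -/
def fieldScale {F : Type*} [Field F] (α : F) (D : Set ((F →+* ℝ) → ℝ)) :
    Set ((F →+* ℝ) → ℝ) :=
  (fun y σ => σ α * y σ) '' D

/-- Membership in `E_{f,+}`: a totally positive unit congruent to `1 mod f`. -/
def memEfPlus {F : Type*} [Field F] [NumberField F] (f : Ideal (𝓞 F))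
    (ε : (𝓞 F)ˣ) : Prop :=
  (∀ σ : F →+* ℝ, 0 < σ ((ε : 𝓞 F) : F)) ∧ ((ε : 𝓞 F) - 1) ∈ f

section ConeDecomposition

variable {V : Type*} [AddCommGroup V] [Module ℝ V]

/-- The open cone spanned by a finite set of vectors. -/
def openCone (s : Finset V) : Set V :=
  {y | ∃ t : V → ℝ, (∀ v ∈ s, 0 < t v) ∧ y = ∑ v ∈ s, t v • v}

/-- A finite set of linearly independent vectors taken from `P`. -/
def IsConeBasis (P : Set V) (s : Finset V) : Prop :=
  (s : Set V) ⊆ P ∧ LinearIndepOn ℝ id (s : Set V)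

/-- A finite disjoint union of open simplicial cones with generators in `P`. -/
def IsConeUnion (P : Set V) (S : Set V) : Prop :=
  ∃ T : Finset (Finset V), (∀ t ∈ T, IsConeBasis P t) ∧
    (T : Set (Finset V)).PairwiseDisjoint openCone ∧ ⋃ t ∈ T, openCone t = S

theorem IsConeUnion.empty (P : Set V) : IsConeUnion P ∅ := ⟨∅, by simp, by simp, by simp⟩

theorem IsConeBasis.isConeUnion {P : Set V} {s : Finset V} (hs : IsConeBasis P s) :
    IsConeUnion P (openCone s) := ⟨{s}, by simpa using hs, by simp, by simp⟩

theorem IsConeUnion.union {P S S' : Set V} (hS : IsConeUnion P S) (hS' : IsConeUnion P S')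
    (h : Disjoint S S') : IsConeUnion P (S ∪ S') := by
  classical
  obtain ⟨T, hT, hd, rfl⟩ := hS
  obtain ⟨T', hT', hd', rfl⟩ := hS'
  refine ⟨T ∪ T', ?_, ?_, ?_⟩
  · intro t ht
    rcases Finset.mem_union.1 ht with h1 | h1
    exacts [hT t h1, hT' t h1]
  · rw [Finset.coe_union]
    refine (Set.pairwiseDisjoint_union).2 ⟨hd, hd', fun i hi j hj _ => ?_⟩
    exact h.mono (Set.subset_biUnion_of_mem (u := openCone) hi)
      (Set.subset_biUnion_of_mem (u := openCone) hj)
  · rw [Finset.set_biUnion_union]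

theorem IsConeUnion.biUnion {P : Set V} {κ : Type*} (K : Finset κ) (S : κ → Set V)
    (hS : ∀ k ∈ K, IsConeUnion P (S k)) (hd : (K : Set κ).PairwiseDisjoint S) :
    IsConeUnion P (⋃ k ∈ K, S k) := by
  classical
  induction K using Finset.induction_on with
  | empty => simpa using IsConeUnion.empty P
  | insert a K ha ih =>
    rw [Finset.set_biUnion_insert]
    refine (hS a (by simp)).union (ih (fun k hk => hS k (by simp [hk]))
      (hd.subset (by simp))) ?_
    rw [Set.disjoint_iUnion₂_right]
    exact fun k hk => hd (by simp) (by simp [hk]) (by rintro rfl; exact ha hk)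

theorem IsConeUnion.inter {P S : Set V} (hS : IsConeUnion P S) (H : Set V)
    (hH : ∀ s, IsConeBasis P s → IsConeUnion P (openCone s ∩ H)) : IsConeUnion P (S ∩ H) := by
  obtain ⟨T, hT, hd, rfl⟩ := hS
  rw [Set.iUnion₂_inter]
  exact IsConeUnion.biUnion T _ (fun t ht => hH t (hT t ht))
    (hd.mono fun t => Set.inter_subset_left)

section Split

variable [DecidableEq V] {v₁ v₂ : V} {r : Finset V}

theorem mem_openCone_insert {v : V} (h : v ∉ r) {y : V} :
    y ∈ openCone (insert v r) ↔ ∃ (a : ℝ) (g : V → ℝ), 0 < a ∧ (∀ v ∈ r, 0 < g v) ∧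
      y = a • v + ∑ v ∈ r, g v • v := by
  constructor
  · rintro ⟨t, ht, rfl⟩
    exact ⟨t v, t, ht v (by simp), fun u hu => ht u (by simp [hu]), Finset.sum_insert h⟩
  · rintro ⟨a, g, ha, hg, rfl⟩
    have hne : ∀ u ∈ r, u ≠ v := fun u hu e => h (e ▸ hu)
    refine ⟨Function.update g v a, fun u hu => ?_, ?_⟩
    · rcases Finset.mem_insert.1 hu with rfl | hu
      · simpa using ha
      · simpa [Function.update_of_ne (hne u hu)] using hg u hu
    · rw [Finset.sum_insert h, Function.update_self]
      congr 1
      exact Finset.sum_congr rfl fun u hu => by rw [Function.update_of_ne (hne u hu)]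

theorem mem_openCone_insert_insert (h₁ : v₁ ∉ insert v₂ r) (h₂ : v₂ ∉ r) {y : V} :
    y ∈ openCone (insert v₁ (insert v₂ r)) ↔ ∃ (a b : ℝ) (g : V → ℝ), 0 < a ∧ 0 < b ∧
      (∀ v ∈ r, 0 < g v) ∧ y = a • v₁ + b • v₂ + ∑ v ∈ r, g v • v := by
  rw [mem_openCone_insert h₁]
  constructor
  · rintro ⟨a, g, ha, hg, rfl⟩
    exact ⟨a, g v₂, g, ha, hg _ (by simp), fun u hu => hg u (by simp [hu]),
      by rw [Finset.sum_insert h₂, add_assoc]⟩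
  · rintro ⟨a, b, g, ha, hb, hg, rfl⟩
    have hy : b • v₂ + ∑ v ∈ r, g v • v ∈ openCone (insert v₂ r) :=
      (mem_openCone_insert h₂).2 ⟨b, g, hb, hg, rfl⟩
    obtain ⟨t, ht, he⟩ := hy
    exact ⟨a, t, ha, ht, by rw [add_assoc, he]⟩

theorem linearIndepOn_insert_insert_iff (h₁ : v₁ ∉ insert v₂ r) (h₂ : v₂ ∉ r) :
    LinearIndepOn ℝ id ((insert v₁ (insert v₂ r) : Finset V) : Set V) ↔
      ∀ (a b : ℝ) (g : V → ℝ), a • v₁ + b • v₂ + ∑ v ∈ r, g v • v = 0 →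
        a = 0 ∧ b = 0 ∧ ∀ v ∈ r, g v = 0 := by
  have h₁₂ : v₁ ≠ v₂ := fun e => h₁ (by simp [e])
  have h₁r : v₁ ∉ r := fun e => h₁ (by simp [e])
  rw [linearIndepOn_finset_iff]
  constructor
  · intro H a b g h
    have hne₁ : ∀ u ∈ r, u ≠ v₁ := fun u hu e => h₁r (e ▸ hu)
    have hne₂ : ∀ u ∈ r, u ≠ v₂ := fun u hu e => h₂ (e ▸ hu)
    have key := H (Function.update (Function.update g v₂ b) v₁ a) (by
      rw [Finset.sum_insert h₁, Finset.sum_insert h₂, Function.update_self,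
        Function.update_of_ne h₁₂.symm, Function.update_self, ← add_assoc, ← h]
      congr 1
      exact Finset.sum_congr rfl fun u hu => by
        rw [Function.update_of_ne (hne₁ u hu), Function.update_of_ne (hne₂ u hu), id])
    refine ⟨by simpa using key v₁ (by simp), by simpa [h₁₂.symm] using key v₂ (by simp),
      fun u hu => ?_⟩
    simpa [hne₁ u hu, hne₂ u hu] using key u (by simp [hu])
  · intro H g h
    rw [Finset.sum_insert h₁, Finset.sum_insert h₂, ← add_assoc] at h
    obtain ⟨ha, hb, hg⟩ := H _ _ _ h
    intro u hu
    rcases Finset.mem_insert.1 hu with rfl | hu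
    · exact ha
    rcases Finset.mem_insert.1 hu with rfl | hu
    exacts [hb, hg u hu]

theorem smul_add_smul_notMem_of_linearIndepOn (h₁ : v₁ ∉ insert v₂ r) (h₂ : v₂ ∉ r)
    (hI : LinearIndepOn ℝ id ((insert v₁ (insert v₂ r) : Finset V) : Set V)) {α β : ℝ}
    (hα : 0 < α) (hβ : 0 < β) : α • v₁ + β • v₂ ∉ insert v₁ (insert v₂ r) := by
  rw [linearIndepOn_insert_insert_iff h₁ h₂] at hI
  intro h
  rcases Finset.mem_insert.1 h with h | h
  · have := (hI (α - 1) β 0 (by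
      simp only [Pi.zero_apply, zero_smul, Finset.sum_const_zero, add_zero]
      rw [sub_smul, one_smul, sub_add_eq_add_sub, h, sub_self])).2.1
    exact hβ.ne' this
  rcases Finset.mem_insert.1 h with h | h
  · have := (hI α (β - 1) 0 (by
      simp only [Pi.zero_apply, zero_smul, Finset.sum_const_zero, add_zero]
      rw [sub_smul, one_smul, ← add_sub_assoc, h, sub_self])).1
    exact hα.ne' this
  · have := (hI α β (Pi.single (α • v₁ + β • v₂) (-1)) (by
      rw [Finset.sum_eq_single_of_mem _ h fun b _ hb => by rw [Pi.single_eq_of_ne hb, zero_smul]]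
      rw [Pi.single_eq_same]
      module)).1
    exact hα.ne' this

theorem linearIndepOn_insert_combination (h₁ : v₁ ∉ insert v₂ r) (h₂ : v₂ ∉ r)
    (hI : LinearIndepOn ℝ id ((insert v₁ (insert v₂ r) : Finset V) : Set V)) {α β : ℝ}
    (hα : 0 < α) (hβ : 0 < β) :
    LinearIndepOn ℝ id ((insert v₁ (insert (α • v₁ + β • v₂) r) : Finset V) : Set V) := by
  have hw := smul_add_smul_notMem_of_linearIndepOn h₁ h₂ hI hα hβ
  simp only [Finset.mem_insert, not_or] at hw h₁
  rw [linearIndepOn_insert_insert_iff (by simp [h₁.2, Ne.symm hw.1]) hw.2.2]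
  rw [linearIndepOn_insert_insert_iff (by simpa using h₁) h₂] at hI
  intro a c g h
  obtain ⟨h1, h2, h3⟩ := hI (a + c * α) (c * β) g (by rw [← h]; module)
  have hc : c = 0 := by simpa [hβ.ne'] using h2
  subst hc
  exact ⟨by simpa using h1, rfl, h3⟩

/-- Stellar subdivision of an open simplicial cone along an edge. -/
theorem openCone_insert_insert_eq (h₁ : v₁ ∉ insert v₂ r) (h₂ : v₂ ∉ r)
    (hI : LinearIndepOn ℝ id ((insert v₁ (insert v₂ r) : Finset V) : Set V)) {α β : ℝ}
    (hα : 0 < α) (hβ : 0 < β) {w : V} (hw : w = α • v₁ + β • v₂) :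
    openCone (insert v₁ (insert v₂ r)) =
        openCone (insert v₁ (insert w r)) ∪ openCone (insert w r) ∪
          openCone (insert v₂ (insert w r)) ∧
      Disjoint (openCone (insert v₁ (insert w r))) (openCone (insert w r)) ∧
      Disjoint (openCone (insert v₁ (insert w r)) ∪ openCone (insert w r))
        (openCone (insert v₂ (insert w r))) := by
  have hw' := smul_add_smul_notMem_of_linearIndepOn h₁ h₂ hI hα hβ
  rw [← hw] at hw'
  simp only [Finset.mem_insert, not_or] at hw'
  have hI' := (linearIndepOn_insert_insert_iff h₁ h₂).1 hI
  have huniq : ∀ (a b a' b' : ℝ) (g g' : V → ℝ),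
      a • v₁ + b • v₂ + ∑ v ∈ r, g v • v = a' • v₁ + b' • v₂ + ∑ v ∈ r, g' v • v →
      a = a' ∧ b = b' := by
    intro a b a' b' g g' h
    obtain ⟨h1, h2, -⟩ := hI' (a - a') (b - b') (g - g') (by
      simp only [Pi.sub_apply, sub_smul, Finset.sum_sub_distrib]
      rw [← sub_eq_zero] at h
      rw [← h]
      abel)
    exact ⟨sub_eq_zero.1 h1, sub_eq_zero.1 h2⟩
  have h₁' := h₁
  simp only [Finset.mem_insert, not_or] at h₁'
  have hv₁ : v₁ ∉ insert w r := by simp [h₁'.2, Ne.symm hw'.1]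
  have hv₂ : v₂ ∉ insert w r := by simp [h₂, Ne.symm hw'.2.1]
  have m0 : ∀ y, y ∈ openCone (insert v₁ (insert v₂ r)) ↔ _ :=
    fun y => mem_openCone_insert_insert h₁ h₂
  have m1 : ∀ y, y ∈ openCone (insert v₁ (insert w r)) ↔ _ :=
    fun y => mem_openCone_insert_insert hv₁ hw'.2.2
  have m2 : ∀ y, y ∈ openCone (insert w r) ↔ _ := fun y => mem_openCone_insert hw'.2.2
  have m3 : ∀ y, y ∈ openCone (insert v₂ (insert w r)) ↔ _ :=
    fun y => mem_openCone_insert_insert hv₂ hw'.2.2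
  refine ⟨?_, ?_, ?_⟩
  · ext y
    rw [Set.mem_union, Set.mem_union, m0, m1, m2, m3]
    constructor
    · rintro ⟨a, b, g, ha, hb, hg, rfl⟩
      rcases lt_trichotomy (b / β) (a / α) with h | h | h
      · refine Or.inl (Or.inl ⟨a - b / β * α, b / β, g, ?_, by positivity, hg, ?_⟩)
        · rw [lt_div_iff₀ hα] at h
          linarith
        · have : b / β * β = b := by field_simp
          rw [hw, smul_add, smul_smul, smul_smul, this]
          module
      · refine Or.inl (Or.inr ⟨b / β, g, by positivity, hg, ?_⟩)
        have h2 : b / β * β = b := by field_simp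
        have h3 : b / β * α = a := by rw [h]; field_simp
        rw [hw, smul_add, smul_smul, smul_smul, h2, h3]
      · refine Or.inr ⟨b - a / α * β, a / α, g, ?_, by positivity, hg, ?_⟩
        · rw [lt_div_iff₀ hβ] at h
          linarith
        · have : a / α * α = a := by field_simp
          rw [hw, smul_add, smul_smul, smul_smul, this]
          module
    · rintro ((⟨a, c, g, ha, hc, hg, rfl⟩ | ⟨c, g, hc, hg, rfl⟩) | ⟨b, c, g, hb, hc, hg, rfl⟩)
      · exact ⟨a + c * α, c * β, g, by positivity, by positivity, hg, by rw [hw]; module⟩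
      · exact ⟨c * α, c * β, g, by positivity, by positivity, hg, by rw [hw]; module⟩
      · exact ⟨c * α, b + c * β, g, by positivity, by positivity, hg, by rw [hw]; module⟩
  · rw [Set.disjoint_left]
    intro y h h'
    obtain ⟨a, c, g, ha, hc, hg, rfl⟩ := (m1 y).1 h
    obtain ⟨c', g', hc', hg', he⟩ := (m2 _).1 h'
    obtain ⟨e1, e2⟩ := huniq (a + c * α) (c * β) (c' * α) (c' * β) g g' (by
      rw [hw] at he
      refine Eq.trans ?_ (he.trans ?_) <;> module)
    have : c = c' := mul_right_cancel₀ hβ.ne' e2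
    subst this
    linarith
  · rw [Set.disjoint_left]
    rintro y h h'
    obtain ⟨b', c', g', hb', hc', hg', he⟩ := (m3 y).1 h'
    have key : ∃ (a c : ℝ) (g : V → ℝ), 0 ≤ a ∧ y = a • v₁ + c • w + ∑ v ∈ r, g v • v := by
      rcases h with h | h
      · obtain ⟨a, c, g, ha, hc, hg, rfl⟩ := (m1 y).1 h
        exact ⟨a, c, g, ha.le, rfl⟩
      · obtain ⟨c, g, hc, hg, rfl⟩ := (m2 y).1 h
        exact ⟨0, c, g, le_rfl, by simp⟩
    obtain ⟨a, c, g, ha, rfl⟩ := key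
    obtain ⟨e1, e2⟩ := huniq (a + c * α) (c * β) (c' * α) (b' + c' * β) g g' (by
      rw [hw] at he
      refine Eq.trans ?_ (he.trans ?_) <;> module)
    have h1 : c' < c := by
      by_contra! hcc
      have := mul_le_mul_of_nonneg_right hcc hβ.le
      linarith
    have := mul_lt_mul_of_pos_right h1 hα
    linarith

end Split

theorem exists_nat_mul_add_nat_mul_eq_zero {p q : ℚ} (hp : 0 < p) (hq : q < 0) :
    ∃ a b : ℕ, 0 < a ∧ 0 < b ∧ (a : ℚ) * p + b * q = 0 := by
  refine ⟨q.num.natAbs * p.den, p.num.natAbs * q.den, ?_, ?_, ?_⟩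
  · exact Nat.mul_pos (Int.natAbs_pos.2 (Rat.num_ne_zero.2 hq.ne)) p.den_pos
  · exact Nat.mul_pos (Int.natAbs_pos.2 (Rat.num_ne_zero.2 hp.ne')) q.den_pos
  · have h1 : ((q.num.natAbs : ℕ) : ℚ) = -(q.num : ℚ) := by
      rw [Nat.cast_natAbs, abs_of_neg (Rat.num_neg.2 hq)]
      push_cast
      rfl
    have h2 : ((p.num.natAbs : ℕ) : ℚ) = (p.num : ℚ) := by
      rw [Nat.cast_natAbs, abs_of_pos (Rat.num_pos.2 hp)]
    push_cast
    rw [h1, h2]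
    have h3 := Rat.den_mul_eq_num p
    have h4 := Rat.den_mul_eq_num q
    rw [← h3, ← h4]
    ring

variable {P : Set V}

theorem IsConeBasis.isConeUnion_halfSpace
    (hP : ∀ x ∈ P, ∀ y ∈ P, ∀ a b : ℕ, 0 < a → 0 < b → (a : ℝ) • x + (b : ℝ) • y ∈ P)
    (l : V →ₗ[ℝ] ℝ) (hl : ∀ x ∈ P, ∃ q : ℚ, l x = q) {s : Finset V} (hs : IsConeBasis P s) :
    IsConeUnion P (openCone s ∩ {y | 0 < l y}) ∧ IsConeUnion P (openCone s \ {y | 0 < l y}) := by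
  classical
  induction hn : (s.filter fun v => l v ≠ 0).card using Nat.strong_induction_on generalizing s with
  | _ n ih =>
  by_cases hpos : ∃ v ∈ s, 0 < l v
  · obtain ⟨v₁, hv₁, hp⟩ := hpos
    by_cases hneg : ∃ v ∈ s, l v < 0
    · obtain ⟨v₂, hv₂, hq⟩ := hneg
      obtain ⟨p, hp'⟩ := hl v₁ (hs.1 hv₁)
      obtain ⟨q, hq'⟩ := hl v₂ (hs.1 hv₂)
      rw [hp'] at hp
      rw [hq'] at hq
      obtain ⟨a, b, ha, hb, hab⟩ := exists_nat_mul_add_nat_mul_eq_zero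
        (by exact_mod_cast hp) (by exact_mod_cast hq)
      have hne : v₂ ≠ v₁ := by
        rintro rfl
        linarith
      obtain ⟨r, hr⟩ : ∃ r, r = (s.erase v₁).erase v₂ := ⟨_, rfl⟩
      have hse : s = insert v₁ (insert v₂ r) := by
        rw [hr, Finset.insert_erase (Finset.mem_erase.2 ⟨hne, hv₂⟩), Finset.insert_erase hv₁]
      have h₁ : v₁ ∉ insert v₂ r := by simp [hr, hne.symm]
      have h₂ : v₂ ∉ r := by simp [hr]
      clear hr
      subst hse
      have haR : (0 : ℝ) < a := by exact_mod_cast ha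
      have hbR : (0 : ℝ) < b := by exact_mod_cast hb
      obtain ⟨w, hw⟩ : ∃ w, w = (a : ℝ) • v₁ + (b : ℝ) • v₂ := ⟨_, rfl⟩
      have hlw : l w = 0 := by
        rw [hw, map_add, map_smul, map_smul, hp', hq', smul_eq_mul, smul_eq_mul]
        exact_mod_cast hab
      have hwP : w ∈ P := hw ▸ hP _ (hs.1 hv₁) _ (hs.1 hv₂) a b ha hb
      obtain ⟨hunion, hd₁, hd₂⟩ := openCone_insert_insert_eq h₁ h₂ hs.2 haR hbR hw
      have hcomm : (insert v₁ (insert v₂ r) : Finset V) = insert v₂ (insert v₁ r) :=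
        Finset.insert_comm _ _ _
      have hrP : (r : Set V) ⊆ P := fun v hv => hs.1 (by simp [Finset.mem_coe.1 hv])
      have hb₁ : IsConeBasis P (insert v₁ (insert w r)) := by
        refine ⟨?_, hw ▸ linearIndepOn_insert_combination h₁ h₂ hs.2 haR hbR⟩
        rw [Finset.coe_insert, Finset.coe_insert]
        exact Set.insert_subset (hs.1 hv₁) (Set.insert_subset hwP hrP)
      have hb₂ : IsConeBasis P (insert v₂ (insert w r)) := by
        refine ⟨?_, ?_⟩
        · rw [Finset.coe_insert, Finset.coe_insert]
          exact Set.insert_subset (hs.1 hv₂) (Set.insert_subset hwP hrP)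
        · have h₁r : v₁ ∉ r := fun h => h₁ (by simp [h])
          have := linearIndepOn_insert_combination (v₁ := v₂) (v₂ := v₁) (r := r)
            (by simp [h₂, hne]) h₁r (hcomm ▸ hs.2) hbR haR
          rwa [add_comm, ← hw] at this
      have hb₃ : IsConeBasis P (insert w r) :=
        ⟨fun v hv => hb₁.1 (by simp_all), hb₁.2.mono (by simp)⟩
      have hlt : ∀ t : Finset V, (∃ u ∈ (insert v₁ (insert v₂ r) : Finset V), l u ≠ 0 ∧ u ∉ t) →
          t ⊆ insert w (insert v₁ (insert v₂ r)) →
          (t.filter fun v => l v ≠ 0).card < n := by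
        rintro t ⟨u, hu, hlu, hut⟩ hsub
        rw [← hn]
        refine Finset.card_lt_card ⟨fun v hv => ?_, fun h => ?_⟩
        · simp only [Finset.mem_filter] at hv ⊢
          rcases Finset.mem_insert.1 (hsub hv.1) with rfl | h
          · exact absurd hlw hv.2
          · exact ⟨h, hv.2⟩
        · exact hut (Finset.mem_filter.1 (h (Finset.mem_filter.2 ⟨hu, hlu⟩))).1
      have hl₁ : l v₁ ≠ 0 := by rw [hp']; exact hp.ne'
      have hl₂ : l v₂ ≠ 0 := by rw [hq']; exact hq.ne
      have hw₁ : v₁ ≠ w := by rintro rfl; exact hl₁ hlw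
      have hw₂ : v₂ ≠ w := by rintro rfl; exact hl₂ hlw
      have h₁r : v₁ ∉ r := fun h => h₁ (by simp [h])
      have hs₁ : insert v₁ (insert w r) ⊆ insert w (insert v₁ (insert v₂ r)) := by
        rw [Finset.insert_comm]
        exact Finset.insert_subset_insert _
          (Finset.insert_subset_insert _ (Finset.subset_insert _ _))
      have hs₂ : insert v₂ (insert w r) ⊆ insert w (insert v₁ (insert v₂ r)) := by
        rw [Finset.insert_comm]
        exact Finset.insert_subset_insert _ (Finset.subset_insert _ _)
      have i₁ := ih _ (hlt _ ⟨v₂, hv₂, hl₂, by simp [hne, hw₂, h₂]⟩ hs₁) hb₁ rfl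
      have i₂ := ih _ (hlt _ ⟨v₁, hv₁, hl₁, by simp [hne.symm, hw₁, h₁r]⟩ hs₂) hb₂ rfl
      have i₃ := ih _ (hlt _ ⟨v₁, hv₁, hl₁, by simp [hw₁, h₁r]⟩
        ((Finset.subset_insert _ _).trans hs₁)) hb₃ rfl
      rw [hunion, Set.union_inter_distrib_right, Set.union_inter_distrib_right,
        Set.union_sdiff_distrib, Set.union_sdiff_distrib]
      constructor
      · refine (i₁.1.union i₃.1 ?_).union i₂.1 ?_
        · exact hd₁.mono Set.inter_subset_left Set.inter_subset_left
        · rw [← Set.union_inter_distrib_right]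
          exact hd₂.mono Set.inter_subset_left Set.inter_subset_left
      · refine (i₁.2.union i₃.2 ?_).union i₂.2 ?_
        · exact hd₁.mono Set.sdiff_subset Set.sdiff_subset
        · rw [← Set.union_sdiff_distrib]
          exact hd₂.mono Set.sdiff_subset Set.sdiff_subset
    · push Not at hneg
      have hsub : openCone s ⊆ {y | 0 < l y} := by
        rintro y ⟨t, ht, rfl⟩
        simp only [Set.mem_ofPred_eq, map_sum, map_smul, smul_eq_mul]
        exact Finset.sum_pos' (fun v hv => mul_nonneg (ht v hv).le (hneg v hv))
          ⟨v₁, hv₁, mul_pos (ht v₁ hv₁) hp⟩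
      rw [Set.inter_eq_left.2 hsub, Set.sdiff_eq_empty.2 hsub]
      exact ⟨hs.isConeUnion, IsConeUnion.empty P⟩
  · push Not at hpos
    have hdis : Disjoint (openCone s) {y | 0 < l y} := by
      rw [Set.disjoint_left]
      rintro y ⟨t, ht, rfl⟩
      simp only [Set.mem_ofPred_eq, map_sum, map_smul, smul_eq_mul, not_lt]
      exact Finset.sum_nonpos fun v hv => mul_nonpos_of_nonneg_of_nonpos (ht v hv).le (hpos v hv)
    rw [hdis.inter_eq, hdis.sdiff_eq_left]
    exact ⟨IsConeUnion.empty P, hs.isConeUnion⟩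

theorem IsConeUnion.diff_biInter
    (hP : ∀ x ∈ P, ∀ y ∈ P, ∀ a b : ℕ, 0 < a → 0 < b → (a : ℝ) • x + (b : ℝ) • y ∈ P)
    {ι : Type*} (I : Finset ι) (l : ι → V →ₗ[ℝ] ℝ) (hl : ∀ i, ∀ x ∈ P, ∃ q : ℚ, l i x = q)
    {S : Set V} (hS : IsConeUnion P S) : IsConeUnion P (S \ {y | ∀ i ∈ I, 0 < l i y}) := by
  classical
  induction I using Finset.induction_on generalizing S with
  | empty => simpa using IsConeUnion.empty P
  | insert a I ha ih =>
    have e : S \ {y | ∀ i ∈ insert a I, 0 < l i y} =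
        (S ∩ {y | 0 < l a y}ᶜ) ∪ ((S ∩ {y | 0 < l a y}) \ {y | ∀ i ∈ I, 0 < l i y}) := by
      ext y
      simp only [Set.mem_sdiff, Set.mem_union, Set.mem_inter_iff, Set.mem_compl_iff,
        Set.mem_ofPred_eq, Finset.forall_mem_insert]
      tauto
    rw [e]
    refine (hS.inter _ fun s hs => (hs.isConeUnion_halfSpace hP (l a) (hl a)).2).union
      (ih (hS.inter _ fun s hs => (hs.isConeUnion_halfSpace hP (l a) (hl a)).1)) ?_
    rw [Set.disjoint_left]
    exact fun y h h' => h.2 h'.1.2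

theorem IsConeUnion.diff_biUnion {κ : Type*} {S : Set V} (hS : IsConeUnion P S) (K : Finset κ)
    (Z : κ → Set V) (hZ : ∀ k ∈ K, ∀ S, IsConeUnion P S → IsConeUnion P (S \ Z k)) :
    IsConeUnion P (S \ ⋃ k ∈ K, Z k) := by
  classical
  induction K using Finset.induction_on generalizing S with
  | empty => simpa using hS
  | insert a K ha ih =>
    rw [Finset.set_biUnion_insert, ← Set.sdiff_sdiff]
    exact ih (hZ a (by simp) S hS) fun k hk => hZ k (by simp [hk])

end ConeDecomposition

section TotallyReal

variable {F : Type*} [Field F]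

/-- The infinite place attached to a real embedding. -/
noncomputable def realPlace (σ : F →+* ℝ) : InfinitePlace F :=
  InfinitePlace.mk (Complex.ofRealHom.comp σ)

theorem realPlace_apply (σ : F →+* ℝ) (x : F) : realPlace σ x = |σ x| := by
  rw [realPlace, InfinitePlace.apply]
  simp

theorem realPlace_bijective [IsTotallyReal F] : Function.Bijective (realPlace (F := F)) := by
  constructor
  · intro σ τ h
    have h' : Complex.ofRealHom.comp σ = Complex.ofRealHom.comp τ := by
      rcases InfinitePlace.mk_eq_iff.1 h with h | h
      · exact h
      · rw [← h]
        ext x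
        simp [ComplexEmbedding.conjugate_coe_eq]
    ext x
    have := RingHom.congr_fun h' x
    simpa using this
  · intro w
    refine ⟨InfinitePlace.embedding_of_isReal (IsTotallyReal.isReal w), ?_⟩
    rw [realPlace]
    conv_rhs => rw [← InfinitePlace.mk_embedding w]
    congr 1
    ext x
    exact InfinitePlace.embedding_of_isReal_apply _ x

variable [NumberField F]

theorem card_realEmbedding [IsTotallyReal F] :
    Fintype.card (F →+* ℝ) = Module.finrank ℚ F := by
  rw [Fintype.card_of_bijective realPlace_bijective, ← InfinitePlace.card_add_two_mul_card_eq_rank,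
    IsTotallyReal.nrComplexPlaces_eq_zero, InfinitePlace.card_eq_nrRealPlaces_add_nrComplexPlaces,
    IsTotallyReal.nrComplexPlaces_eq_zero]

instance [IsTotallyReal F] : Nonempty (F →+* ℝ) :=
  (realPlace_bijective (F := F)).surjective.nonempty

theorem exists_one_le_abs_embedding [IsTotallyReal F] {a : 𝓞 F} (ha : a ≠ 0) :
    ∃ σ : F →+* ℝ, 1 ≤ |σ a| := by
  by_contra! h
  obtain ⟨σ⟩ : Nonempty (F →+* ℝ) := inferInstance
  have := InfinitePlace.one_le_of_lt_one (w := realPlace σ) ha fun z _ => by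
    obtain ⟨τ, rfl⟩ := realPlace_bijective.surjective z
    exact (realPlace_apply τ _).trans_lt (h τ)
  exact absurd (this.trans_eq (realPlace_apply σ _)) (h σ).not_ge

theorem exists_embedding_unit_le_one [IsTotallyReal F] (u : (𝓞 F)ˣ) :
    ∃ σ : F →+* ℝ, σ ((u : 𝓞 F) : F) ≤ 1 := by
  obtain ⟨σ, hσ⟩ := exists_one_le_abs_embedding (a := ((u⁻¹ : (𝓞 F)ˣ) : 𝓞 F)) (Units.ne_zero _)
  refine ⟨σ, ?_⟩
  have h : σ ((u : 𝓞 F) : F) * σ (((u⁻¹ : (𝓞 F)ˣ) : 𝓞 F) : F) = 1 := by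
    rw [← map_mul, ← map_mul, Units.mul_inv, map_one, map_one]
  have h2 : |σ ((u : 𝓞 F) : F)| * |σ (((u⁻¹ : (𝓞 F)ˣ) : 𝓞 F) : F)| = 1 := by
    rw [← abs_mul, h, abs_one]
  refine (le_abs_self _).trans ?_
  nlinarith [abs_nonneg (σ ((u : 𝓞 F) : F))]

theorem unit_eq_one_of_embedding_lt_two [IsTotallyReal F] {u : (𝓞 F)ˣ}
    (h : ∀ σ : F →+* ℝ, 0 < σ ((u : 𝓞 F) : F) ∧ σ ((u : 𝓞 F) : F) < 2) : u = 1 := by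
  by_contra hne
  have h0 : (u : 𝓞 F) - 1 ≠ 0 := fun e => hne (Units.ext (sub_eq_zero.1 e))
  obtain ⟨σ, hσ⟩ := exists_one_le_abs_embedding h0
  have e : σ (((u : 𝓞 F) - 1 : 𝓞 F) : F) = σ ((u : 𝓞 F) : F) - 1 := by simp
  rw [e] at hσ
  have := h σ
  rcases le_abs.1 hσ with h | h <;> linarith

theorem span_range_embedding :
    Submodule.span ℝ (Set.range fun (x : F) (σ : F →+* ℝ) => σ x) = ⊤ := by
  by_contra hne
  obtain ⟨φ, hφ, hle⟩ := Submodule.exists_le_ker_of_lt_top _ (lt_top_iff_ne_top.2 hne)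
  have hind : LinearIndependent ℝ fun (σ : F →+* ℝ) (x : F) => σ x :=
    (linearIndependent_monoidHom F ℝ).comp (fun σ : F →+* ℝ => (σ : F →* ℝ))
      fun σ τ h => by ext x; exact DFunLike.congr_fun h x
  classical
  rw [Fintype.linearIndependent_iff] at hind
  have h0 : ∀ σ, φ (Pi.single σ 1) = 0 := hind (fun σ => φ (Pi.single σ 1)) (by
    ext x
    have hx : φ (fun σ : F →+* ℝ => σ x) = 0 := hle (Submodule.subset_span ⟨x, rfl⟩)
    rw [pi_eq_sum_univ' (fun σ : F →+* ℝ => σ x)] at hx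
    simpa [mul_comm] using hx)
  refine hφ (LinearMap.pi_ext' fun σ => LinearMap.ext_ring ?_)
  simpa using h0 σ

theorem dense_range_embedding : Dense (Set.range fun (x : F) (σ : F →+* ℝ) => σ x) := by
  intro y
  have hy : y ∈ Submodule.span ℝ (Set.range fun (x : F) (σ : F →+* ℝ) => σ x) := by
    rw [span_range_embedding]
    trivial
  induction hy using Submodule.span_induction with
  | mem y hy => exact subset_closure hy
  | zero => exact subset_closure ⟨0, by ext; simp⟩
  | add y z _ _ hy hz =>
    refine map_mem_closure₂ continuous_add hy hz ?_
    rintro _ ⟨a, rfl⟩ _ ⟨b, rfl⟩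
    exact ⟨a + b, by ext; simp⟩
  | smul c y _ hy =>
    refine map_mem_closure₂ (f := fun (c : ℝ) (y : (F →+* ℝ) → ℝ) => c • y) continuous_smul
      (Rat.denseRange_cast c) hy ?_
    rintro _ ⟨q, rfl⟩ _ ⟨b, rfl⟩
    exact ⟨q * b, by ext; simp⟩

end TotallyReal

section LocalCone

theorem exists_dense_cone_mem {ι : Type*} [Fintype ι] [Nonempty ι] {x : ι → ℝ} (hx : ∀ i, 0 < x i)
    {Q S : Set (ι → ℝ)} (hQ : IsOpen Q) (hxQ : x ∈ Q) (hS : Dense S) :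
    ∃ (w : ι → ι → ℝ) (c : ι → ℝ), (∀ i, w i ∈ S ∧ w i ∈ Q) ∧ LinearIndependent ℝ w ∧
      (∀ i, 0 < c i) ∧ x = ∑ i, c i • w i := by
  classical
  have hcont : Continuous fun w : ι → ι → ℝ => Matrix.transpose (Matrix.of w) :=
    Continuous.matrix_transpose continuous_id
  have hO : IsOpen {w : ι → ι → ℝ | ∀ i, w i ∈ Q ∧
      0 < (Matrix.of w).transpose.det * (Matrix.of w).transpose.cramer x i} := by
    simp only [Set.ofPred_forall]
    refine isOpen_iInter_of_finite fun i => ?_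
    refine (hQ.preimage (continuous_apply i)).and (isOpen_lt continuous_const ?_)
    refine hcont.matrix_det.mul ?_
    exact (continuous_apply i).comp (hcont.matrix_cramer continuous_const)
  have hne : {w : ι → ι → ℝ | ∀ i, w i ∈ Q ∧
      0 < (Matrix.of w).transpose.det * (Matrix.of w).transpose.cramer x i}.Nonempty := by
    let v : ℝ → ι → ι → ℝ := fun t i σ => x σ * (1 + t * if σ = i then 1 else 0)
    have hv : ∀ i, Filter.Tendsto (fun t => v t i) (nhdsWithin 0 (Set.Ioi 0)) (nhds x) := by
      intro i
      have : Continuous fun t => v t i := by fun_prop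
      have h0 := this.tendsto 0
      simp only [v, zero_mul, add_zero, mul_one] at h0
      exact h0.mono_left nhdsWithin_le_nhds
    have hev : ∀ᶠ t in nhdsWithin (0 : ℝ) (Set.Ioi 0), ∀ i, v t i ∈ Q :=
      Filter.eventually_all.2 fun i => (hv i).eventually (hQ.mem_nhds hxQ)
    obtain ⟨t, htQ, ht⟩ := (hev.and self_mem_nhdsWithin).exists
    have ht : 0 < t := ht
    refine ⟨v t, fun i => ⟨htQ i, ?_⟩⟩
    have hmul : ∀ z : ι → ℝ, (Matrix.of (v t)).transpose.mulVec z =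
        fun σ => x σ * (∑ j, z j + t * z σ) := by
      intro z
      ext σ
      simp only [Matrix.mulVec, dotProduct, Matrix.transpose_apply, Matrix.of_apply, v]
      simp only [mul_assoc, add_mul, mul_ite, ite_mul, one_mul, mul_one, mul_zero, zero_mul,
        ← Finset.mul_sum, Finset.sum_add_distrib, Finset.sum_ite_eq, Finset.mem_univ, if_true]
    have hdet : (Matrix.of (v t)).transpose.det ≠ 0 := by
      intro h0
      obtain ⟨z, hz, hz0⟩ := Matrix.exists_mulVec_eq_zero_iff.2 h0
      rw [hmul] at hz0
      have h1 : ∀ σ, ∑ j, z j + t * z σ = 0 := fun σ =>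
        (mul_eq_zero.1 (congrFun hz0 σ)).resolve_left (hx σ).ne'
      have h2 : ∑ j, z j = 0 := by
        have := Finset.sum_congr (rfl : (Finset.univ : Finset ι) = _) fun σ _ => h1 σ
        rw [Finset.sum_add_distrib, ← Finset.mul_sum, Finset.sum_const_zero, Finset.sum_const,
          nsmul_eq_mul, ← add_mul] at this
        exact (mul_eq_zero.1 this).resolve_left (by positivity)
      refine hz (funext fun σ => ?_)
      have := h1 σ
      rw [h2, zero_add] at this
      exact (mul_eq_zero.1 this).resolve_left ht.ne'
    have hcr : ∀ i, (Fintype.card ι + t) * (Matrix.of (v t)).transpose.cramer x i =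
        (Matrix.of (v t)).transpose.det := by
      intro i
      have h1 := hmul 1
      have h2 : (fun σ => x σ * (∑ j, (1 : ι → ℝ) j + t * (1 : ι → ℝ) σ)) =
          ((Fintype.card ι : ℝ) + t) • x := by
        ext σ
        simp [mul_comm]
      rw [h2] at h1
      have h3 := congrArg (Matrix.of (v t)).transpose.adjugate.mulVec h1
      rw [Matrix.mulVec_mulVec, Matrix.adjugate_mul, Matrix.mulVec_smul,
        ← Matrix.cramer_eq_adjugate_mulVec, Matrix.smul_mulVec, Matrix.one_mulVec] at h3
      simpa using (congrFun h3 i).symm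
    rw [← hcr i] at hdet ⊢
    have h4 : 0 < (Fintype.card ι : ℝ) + t := by positivity
    have h5 := right_ne_zero_of_mul hdet
    have h6 := mul_self_pos.2 h5
    rw [mul_assoc]
    exact mul_pos h4 h6
  obtain ⟨w, hwO, hwS⟩ := (dense_pi Set.univ fun (_ : ι) _ => hS).inter_open_nonempty _ hO hne
  simp only [Set.mem_pi, Set.mem_univ, true_implies] at hwS
  have hdet : (Matrix.of w).transpose.det ≠ 0 :=
    left_ne_zero_of_mul (hwO (Classical.arbitrary ι)).2.ne'
  refine ⟨w, fun i => (Matrix.of w).transpose.cramer x i / (Matrix.of w).transpose.det,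
    fun i => ⟨hwS i, (hwO i).1⟩, ?_, fun i => ?_, ?_⟩
  · rw [Matrix.det_transpose] at hdet
    exact Matrix.linearIndependent_rows_of_det_ne_zero hdet
  · have := (hwO i).2
    rw [mul_comm] at this
    exact div_pos_iff.2 (mul_pos_iff.1 this)
  · have h1 := Matrix.mulVec_cramer (Matrix.of w).transpose x
    ext σ
    have h2 := congrFun h1 σ
    simp only [Matrix.mulVec, dotProduct, Matrix.transpose_apply, Matrix.of_apply, Pi.smul_apply,
      smul_eq_mul] at h2
    rw [Finset.sum_apply]
    simp only [Pi.smul_apply, smul_eq_mul]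
    refine mul_left_cancel₀ hdet ?_
    rw [← h2, Finset.mul_sum]
    refine Finset.sum_congr rfl fun i _ => ?_
    field_simp

theorem openCone_image {V : Type*} [AddCommGroup V] [Module ℝ V] [DecidableEq V] {ι : Type*}
    [Fintype ι] {w : ι → V} (hw : Function.Injective w) :
    openCone (Finset.univ.image w) =
      {y | ∃ t : ι → ℝ, (∀ i, 0 < t i) ∧ y = ∑ i, t i • w i} := by
  ext y
  constructor
  · rintro ⟨t, ht, rfl⟩
    exact ⟨t ∘ w, fun i => ht _ (Finset.mem_image_of_mem _ (Finset.mem_univ i)),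
      Finset.sum_image hw.injOn⟩
  · rintro ⟨t, ht, rfl⟩
    refine ⟨Function.extend w t 0, ?_, ?_⟩
    · intro v hv
      obtain ⟨i, -, rfl⟩ := Finset.mem_image.1 hv
      rw [hw.extend_apply]
      exact ht i
    · rw [Finset.sum_image hw.injOn]
      simp [hw.extend_apply]

/-- The images in `ℝ^{Hom(F,ℝ)}` of the totally positive integers. -/
def posIntegers (F : Type*) [Field F] : Set ((F →+* ℝ) → ℝ) :=
  {y | ∃ a : 𝓞 F, (∀ σ : F →+* ℝ, 0 < σ a) ∧ y = fun σ => σ a}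

variable {F : Type*} [Field F] [NumberField F]

theorem exists_local_cone [IsTotallyReal F] {x : (F →+* ℝ) → ℝ} (hx : x ∈ posOrthant F)
    {Q : Set ((F →+* ℝ) → ℝ)} (hQ : IsOpen Q) (hxQ : x ∈ Q) (hQX : Q ⊆ posOrthant F)
    (hsmul : ∀ (c : ℝ) y, 0 < c → y ∈ Q → c • y ∈ Q) (hadd : ∀ y ∈ Q, ∀ z ∈ Q, y + z ∈ Q) :
    ∃ (s : Finset ((F →+* ℝ) → ℝ)) (l : (F →+* ℝ) → ((F →+* ℝ) → ℝ) →ₗ[ℝ] ℝ),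
      IsConeBasis (posIntegers F) s ∧ openCone s ⊆ Q ∧ x ∈ openCone s ∧
      openCone s = {y | ∀ i, 0 < l i y} ∧
      ∀ i (a : F), ∃ q : ℚ, l i (fun σ => σ a) = q := by
  classical
  obtain ⟨w, c, hw, hli, hc, hxw⟩ := exists_dense_cone_mem hx hQ hxQ
    (dense_range_embedding (F := F))
  choose a ha using fun i => (hw i).1
  have hmul : ∀ i, ∃ (b : 𝓞 F) (d : ℝ), 0 < d ∧ ∀ σ : F →+* ℝ, σ (b : F) = d * w i σ := by
    intro i
    obtain ⟨d, hd, hdi⟩ := IsAlgebraic.exists_integral_multiple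
      ((IsFractionRing.isAlgebraic_iff ℤ ℚ F).2 (Algebra.IsAlgebraic.isAlgebraic (R := ℚ) (a i)))
    obtain ⟨b, hb⟩ : ∃ b : 𝓞 F, (b : F) = d • a i := ⟨⟨d • a i, hdi⟩, rfl⟩
    refine ⟨(d : 𝓞 F) * b, (d : ℝ) ^ 2, by positivity, fun σ => ?_⟩
    rw [← ha i]
    simp [hb, sq, mul_assoc]
  choose b d hd hb using hmul
  have hbw : ∀ i, (fun σ : F →+* ℝ => σ (b i : F)) = d i • w i := fun i => funext fun σ => hb i σ
  have hbQ : ∀ i, (fun σ : F →+* ℝ => σ (b i : F)) ∈ Q := fun i => by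
    rw [hbw]
    exact hsmul _ _ (hd i) (hw i).2
  have hbli : LinearIndependent ℝ fun i (σ : F →+* ℝ) => σ (b i : F) := by
    have := hli.units_smul fun i => Units.mk0 (d i) (hd i).ne'
    convert this using 1
    exact funext hbw
  let B := basisOfLinearIndependentOfCardEqFinrank hbli (Module.finrank_fintype_fun_eq_card ℝ).symm
  have hB : ∀ i, B i = fun σ : F →+* ℝ => σ (b i : F) := fun i => by simp [B]
  have hcone := openCone_image hbli.injective
  have hsub : openCone (Finset.univ.image fun i (σ : F →+* ℝ) => σ (b i : F)) ⊆ Q := by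
    rw [hcone]
    rintro _ ⟨t, ht, rfl⟩
    exact Finset.sum_induction_nonempty _ (· ∈ Q) (fun y z hy hz => hadd y hy z hz)
      Finset.univ_nonempty fun i _ => hsmul _ _ (ht i) (hbQ i)
  have hQli : LinearIndependent ℚ fun i => (b i : F) := by
    rw [Fintype.linearIndependent_iff] at hbli ⊢
    intro g hg i
    have := hbli (fun i => (g i : ℝ)) (by
      ext σ
      have := congrArg σ hg
      simpa [Algebra.smul_def] using this) i
    exact_mod_cast this
  refine ⟨Finset.univ.image fun i (σ : F →+* ℝ) => σ (b i : F), fun i => B.coord i,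
    ⟨?_, ?_⟩, hsub, ?_, ?_, ?_⟩
  · intro y hy
    obtain ⟨i, -, rfl⟩ := Finset.mem_image.1 (Finset.mem_coe.1 hy)
    exact ⟨b i, fun σ => hQX (hbQ i) σ, rfl⟩
  · rw [Finset.coe_image, Finset.coe_univ, Set.image_univ]
    exact hbli.linearIndepOn_id
  · rw [hcone]
    refine ⟨fun i => c i / d i, fun i => div_pos (hc i) (hd i), ?_⟩
    rw [hxw]
    refine Finset.sum_congr rfl fun i _ => ?_
    rw [hbw, smul_smul, div_mul_cancel₀ _ (hd i).ne']
  · rw [hcone]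
    ext y
    constructor
    · rintro ⟨t, ht, rfl⟩ i
      simp only [← hB]
      rw [B.coord_apply, B.repr_sum_self]
      exact ht i
    · intro hy
      refine ⟨fun i => B.coord i y, hy, ?_⟩
      simp only [← hB]
      exact (B.sum_repr y).symm
  · intro i x
    let C := basisOfLinearIndependentOfCardEqFinrank hQli card_realEmbedding
    refine ⟨C.repr x i, ?_⟩
    have : (fun σ : F →+* ℝ => σ x) = ∑ i, (C.repr x i : ℝ) • B i := by
      ext σ
      have := congrArg σ (C.sum_repr x)
      simp only [hB]
      rw [← this]
      simp [C, Algebra.smul_def]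
    rw [this, B.coord_apply, B.repr_sum_self]

end LocalCone

section Units

variable {F : Type*} [Field F] [NumberField F]

theorem exists_abs_sub_log_place_le :
    ∃ B : ℝ, 0 ≤ B ∧ ∀ g : InfinitePlace F → ℝ, ∃ u : (𝓞 F)ˣ,
      ∀ w : InfinitePlace F, w ≠ Units.dirichletUnitTheorem.w₀ →
        |g w - w.mult * Real.log (w (u : 𝓞 F))| ≤ B := by
  classical
  let b := (Module.Free.chooseBasis ℤ (Units.unitLattice F)).ofZLatticeBasis ℝ
  refine ⟨∑ i, ‖b i‖, Finset.sum_nonneg fun i _ => norm_nonneg _, fun g => ?_⟩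
  let g' : Units.dirichletUnitTheorem.logSpace F := fun w => g w
  have h : (ZSpan.floor b g' : Units.dirichletUnitTheorem.logSpace F) ∈ Units.unitLattice F :=
    ((Module.Free.chooseBasis ℤ (Units.unitLattice F)).ofZLatticeBasis_span ℝ).le
      (ZSpan.floor b g').2
  obtain ⟨u, -, hu⟩ := h
  refine ⟨Additive.toMul u, fun w hw => ?_⟩
  have := ZSpan.norm_fract_le b g'
  rw [ZSpan.fract_apply, ← hu] at this
  have h2 := norm_le_pi_norm (g' - Units.logEmbedding F u) ⟨w, hw⟩
  have h3 : ‖g' - Units.logEmbedding F u‖ ≤  ∑ i, ‖b i‖ := this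
  exact h2.trans h3

theorem exists_abs_add_log_le [IsTotallyReal F] :
    ∃ B : ℝ, ∀ g : (F →+* ℝ) → ℝ, ∑ σ, g σ = 0 →
      ∃ u : (𝓞 F)ˣ, ∀ σ : F →+* ℝ, |g σ + Real.log (σ (u : 𝓞 F))| ≤ B := by
  classical
  obtain ⟨B, hB0, hB⟩ := exists_abs_sub_log_place_le (F := F)
  obtain ⟨σ₀, hσ₀⟩ := realPlace_bijective.surjective
    (Units.dirichletUnitTheorem.w₀ : InfinitePlace F)
  refine ⟨Fintype.card (F →+* ℝ) * B, fun g hg => ?_⟩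
  let e := Equiv.ofBijective _ (realPlace_bijective (F := F))
  obtain ⟨u, hu⟩ := hB fun w => -g (e.symm w)
  refine ⟨u, ?_⟩
  have hcard : (1 : ℝ) ≤ Fintype.card (F →+* ℝ) := by
    exact_mod_cast Nat.one_le_iff_ne_zero.2 Fintype.card_ne_zero
  have hne : ∀ σ, σ ≠ σ₀ → |g σ + Real.log (σ (u : 𝓞 F))| ≤ B := by
    intro σ hσ
    have hw : realPlace σ ≠ Units.dirichletUnitTheorem.w₀ := fun h =>
      hσ (realPlace_bijective.injective (h.trans hσ₀.symm))
    have := hu _ hw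
    rw [IsTotallyReal.mult_eq, realPlace_apply, Real.log_abs, Nat.cast_one, one_mul,
      show e.symm (realPlace σ) = σ from e.symm_apply_apply σ, ← abs_neg, neg_sub, sub_neg_eq_add,
      add_comm] at this
    exact this
  have hsum : ∑ σ : F →+* ℝ, (g σ + Real.log (σ (u : 𝓞 F))) = 0 := by
    rw [Finset.sum_add_distrib, hg, zero_add]
    have := Units.sum_mult_mul_log u
    rw [← realPlace_bijective.sum_comp] at this
    simpa [IsTotallyReal.mult_eq, realPlace_apply] using this
  intro σ
  by_cases hσ : σ = σ₀
  · subst hσ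
    rw [← Finset.add_sum_erase _ _ (Finset.mem_univ σ)] at hsum
    rw [eq_neg_of_add_eq_zero_left hsum, abs_neg]
    refine (Finset.abs_sum_le_sum_abs _ _).trans ?_
    refine (Finset.sum_le_card_nsmul _ _ B fun τ hτ => hne τ (Finset.ne_of_mem_erase hτ)).trans ?_
    rw [nsmul_eq_mul]
    exact mul_le_mul_of_nonneg_right (Nat.cast_le.2 (Finset.card_le_univ _)) hB0
  · exact (hne σ hσ).trans (le_mul_of_one_le_left hB0 hcard)

theorem exists_pow_sub_one_mem {f : Ideal (𝓞 F)} (hf : f ≠ ⊥) :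
    ∃ k : ℕ, 0 < k ∧ ∀ u : (𝓞 F)ˣ, (u : 𝓞 F) ^ k - 1 ∈ f := by
  have : Finite (𝓞 F ⧸ f) := Ideal.finiteQuotientOfFreeOfNeBot f hf
  refine ⟨Nat.card (𝓞 F ⧸ f)ˣ, Nat.card_pos, fun u => ?_⟩
  rw [← Ideal.Quotient.eq, map_pow, map_one]
  exact congrArg Units.val
    (pow_card_eq_one' (x := Units.map (Ideal.Quotient.mk f : 𝓞 F →* 𝓞 F ⧸ f) u))

theorem exists_memEfPlus_mul_le [IsTotallyReal F] {f : Ideal (𝓞 F)} (hf : f ≠ ⊥) :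
    ∃ c : ℝ, ∀ x ∈ posOrthant F, ∃ ε, memEfPlus f ε ∧ ∀ σ τ : F →+* ℝ,
      σ (ε : 𝓞 F) * x σ ≤ c * (τ (ε : 𝓞 F) * x τ) := by
  obtain ⟨B, hB⟩ := exists_abs_add_log_le (F := F)
  obtain ⟨k, hk, hkf⟩ := exists_pow_sub_one_mem hf
  refine ⟨Real.exp (4 * k * B), fun x hx => ?_⟩
  let m := (∑ σ, Real.log (x σ)) / Fintype.card (F →+* ℝ)
  obtain ⟨u, hu⟩ := hB (fun σ => (Real.log (x σ) - m) / (2 * k)) (by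
    rw [← Finset.sum_div, Finset.sum_sub_distrib, Finset.sum_const, nsmul_eq_mul, Finset.card_univ,
      mul_div_cancel₀ _ (by exact_mod_cast Fintype.card_ne_zero), sub_self, zero_div])
  have hu0 : ∀ σ : F →+* ℝ, σ (u : 𝓞 F) ≠ 0 := fun σ => by simp
  refine ⟨(u ^ 2) ^ k, ⟨fun σ => ?_, ?_⟩, fun σ τ => ?_⟩
  · have := hu0 σ
    simp only [Units.val_pow_eq_pow_val, map_pow]
    positivity
  · exact hkf (u ^ 2)
  · have key : ∀ σ : F →+* ℝ, σ (((u ^ 2) ^ k : (𝓞 F)ˣ) : 𝓞 F) * x σ =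
        Real.exp (2 * k * ((Real.log (x σ) - m) / (2 * k) + Real.log (σ (u : 𝓞 F))) + m) := by
      intro σ
      have h1 := hu0 σ
      have h2 : 2 * (k : ℝ) * ((Real.log (x σ) - m) / (2 * k) + Real.log (σ (u : 𝓞 F))) + m =
          k * (2 * Real.log (σ (u : 𝓞 F))) + Real.log (x σ) := by
        field_simp
        ring
      have h3 : 2 * Real.log (σ (u : 𝓞 F)) = Real.log (σ (u : 𝓞 F) ^ 2) := by
        rw [Real.log_pow, Nat.cast_ofNat]
      rw [h2, Real.exp_add, Real.exp_log (hx σ), h3, Real.exp_nat_mul,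
        Real.exp_log (by positivity)]
      simp
    rw [key, key, ← Real.exp_add, Real.exp_le_exp]
    have h1 := abs_le.1 (hu σ)
    have h2 := abs_le.1 (hu τ)
    have hk0 : (0 : ℝ) < 2 * k := by positivity
    nlinarith [mul_le_mul_of_nonneg_left h1.2 hk0.le, mul_le_mul_of_nonneg_left h2.1 hk0.le]

end Units

section FundamentalDomain

variable {F : Type*} [Field F]

/-- The open cone of points whose coordinate ratios are close to those of `x`. -/
def nearCone (x : (F →+* ℝ) → ℝ) : Set ((F →+* ℝ) → ℝ) :=
  {y | (∀ σ, 0 < y σ) ∧ ∀ σ τ, 4 * (y σ * x τ) < 5 * (y τ * x σ)}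

theorem smul_mem_nearCone {x : (F →+* ℝ) → ℝ} {c : ℝ} {y : (F →+* ℝ) → ℝ} (hc : 0 < c)
    (hy : y ∈ nearCone x) : c • y ∈ nearCone x := by
  refine ⟨fun σ => mul_pos hc (hy.1 σ), fun σ τ => ?_⟩
  have := mul_lt_mul_of_pos_left (hy.2 σ τ) hc
  simp only [Pi.smul_apply, smul_eq_mul]
  linarith

theorem add_mem_nearCone {x y z : (F →+* ℝ) → ℝ} (hy : y ∈ nearCone x) (hz : z ∈ nearCone x) :
    y + z ∈ nearCone x := by
  refine ⟨fun σ => add_pos (hy.1 σ) (hz.1 σ), fun σ τ => ?_⟩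
  have := hy.2 σ τ
  have := hz.2 σ τ
  simp only [Pi.add_apply]
  linarith

theorem self_mem_nearCone {x : (F →+* ℝ) → ℝ} (hx : x ∈ posOrthant F) : x ∈ nearCone x :=
  ⟨hx, fun σ τ => by nlinarith [mul_pos (hx σ) (hx τ)]⟩

/-- A rational simplicial cone which is open and contained in some `nearCone`. -/
structure IsLocalCone (C : Set ((F →+* ℝ) → ℝ)) : Prop where
  exists_basis : ∃ s, IsConeBasis (posIntegers F) s ∧ openCone s = C
  exists_functional : ∃ l : (F →+* ℝ) → ((F →+* ℝ) → ℝ) →ₗ[ℝ] ℝ, C = {y | ∀ i, 0 < l i y} ∧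
    ∀ i (a : F), ∃ q : ℚ, l i (fun σ => σ a) = q
  exists_subset : ∃ x ∈ posOrthant F, C ⊆ nearCone x

theorem IsLocalCone.smul_mem_iff {C : Set ((F →+* ℝ) → ℝ)} (hC : IsLocalCone C) {c : ℝ}
    (hc : 0 < c) {y : (F →+* ℝ) → ℝ} : c • y ∈ C ↔ y ∈ C := by
  obtain ⟨l, rfl, -⟩ := hC.exists_functional
  simp [hc]

variable [NumberField F]

theorem isOpen_nearCone (x : (F →+* ℝ) → ℝ) : IsOpen (nearCone x) := by
  refine IsOpen.and ?_ ?_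
  · rw [Set.ofPred_forall]
    exact isOpen_iInter_of_finite fun σ => isOpen_lt (by fun_prop) (by fun_prop)
  · simp only [Set.ofPred_forall]
    exact isOpen_iInter_of_finite fun σ => isOpen_iInter_of_finite fun τ =>
      isOpen_lt (by fun_prop) (by fun_prop)

/-- The action of units on `ℝ^{Hom(F,ℝ)}`, as multiplication by a vector. -/
noncomputable def unitEmbedding (F : Type*) [Field F] [NumberField F] :
    (𝓞 F)ˣ →* ((F →+* ℝ) → ℝ) where
  toFun u σ := σ (u : 𝓞 F)
  map_one' := by ext; simp
  map_mul' _ _ := by ext; simp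

theorem unitEmbedding_inv_mul_cancel (u : (𝓞 F)ˣ) (y : (F →+* ℝ) → ℝ) :
    unitEmbedding F u⁻¹ * (unitEmbedding F u * y) = y := by
  rw [← mul_assoc, ← map_mul, inv_mul_cancel, map_one, one_mul]

/-- The group `E_{f,+}`. -/
def congruenceUnits (f : Ideal (𝓞 F)) : Subgroup (𝓞 F)ˣ where
  carrier := {u | memEfPlus f u}
  one_mem' := ⟨fun σ => by simp, by simp⟩
  mul_mem' {u v} hu hv := by
    refine ⟨fun σ => ?_, ?_⟩
    · simpa using mul_pos (hu.1 σ) (hv.1 σ)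
    · have : ((u * v : (𝓞 F)ˣ) : 𝓞 F) - 1 = u * (v - 1) + (u - 1) := by
        push_cast
        ring
      rw [this]
      exact f.add_mem (f.mul_mem_left _ hv.2) hu.2
  inv_mem' {u} hu := by
    refine ⟨fun σ => ?_, ?_⟩
    · simpa using hu.1 σ
    · have : ((u⁻¹ : (𝓞 F)ˣ) : 𝓞 F) - 1 = -((u⁻¹ : (𝓞 F)ˣ) : 𝓞 F) * (u - 1) := by
        rw [mul_sub, neg_mul, Units.inv_mul]
        ring
      rw [this]
      exact f.mul_mem_left _ hu.2

theorem posIntegers_combination : ∀ x ∈ posIntegers F, ∀ y ∈ posIntegers F, ∀ a b : ℕ,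
    0 < a → 0 < b → (a : ℝ) • x + (b : ℝ) • y ∈ posIntegers F := by
  rintro _ ⟨x, hx, rfl⟩ _ ⟨y, hy, rfl⟩ a b ha hb
  refine ⟨a * x + b * y, fun σ => ?_, ?_⟩
  · have := hx σ
    have := hy σ
    simp only [map_add, map_mul, map_natCast]
    positivity
  · ext σ
    simp

theorem IsLocalCone.isConeUnion_diff {C : Set ((F →+* ℝ) → ℝ)} (hC : IsLocalCone C)
    (u : (𝓞 F)ˣ) {S : Set ((F →+* ℝ) → ℝ)} (hS : IsConeUnion (posIntegers F) S) :
    IsConeUnion (posIntegers F) (S \ {y | unitEmbedding F u * y ∈ C}) := by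
  obtain ⟨l, rfl, hl⟩ := hC.exists_functional
  have := IsConeUnion.diff_biInter posIntegers_combination Finset.univ
    (fun i => l i ∘ₗ LinearMap.mulLeft ℝ (unitEmbedding F u)) ?_ hS
  · simpa using this
  · rintro i _ ⟨a, -, rfl⟩
    obtain ⟨q, hq⟩ := hl i ((u : 𝓞 F) * a)
    refine ⟨q, hq ▸ ?_⟩
    rw [LinearMap.comp_apply]
    congr 1
    ext σ
    exact (map_mul σ _ _).symm

theorem IsLocalCone.isOpen {C : Set ((F →+* ℝ) → ℝ)} (hC : IsLocalCone C) : IsOpen C := by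
  obtain ⟨l, rfl, -⟩ := hC.exists_functional
  rw [Set.ofPred_forall]
  exact isOpen_iInter_of_finite fun i =>
    isOpen_lt continuous_const (l i).continuous_of_finiteDimensional

variable [IsTotallyReal F]

theorem exists_isLocalCone {x : (F →+* ℝ) → ℝ} (hx : x ∈ posOrthant F) :
    ∃ C, IsLocalCone C ∧ x ∈ C := by
  obtain ⟨s, l, hs, hsub, hxs, hl, hq⟩ := exists_local_cone hx (isOpen_nearCone x)
    (self_mem_nearCone hx) (fun y hy => hy.1) (fun c y => smul_mem_nearCone)
    fun y hy z => add_mem_nearCone hy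
  exact ⟨openCone s, ⟨⟨s, hs, rfl⟩, ⟨l, hl, hq⟩, ⟨x, hx, hsub⟩⟩, hxs⟩

theorem exists_localCone_cover {f : Ideal (𝓞 F)} (hf : f ≠ ⊥) :
    ∃ (m : ℕ) (C : Fin m → Set ((F →+* ℝ) → ℝ)), (∀ i, IsLocalCone (C i)) ∧
      ∀ x ∈ posOrthant F, ∃ i, ∃ ε ∈ congruenceUnits f, unitEmbedding F ε * x ∈ C i := by
  obtain ⟨c, hc⟩ := exists_memEfPlus_mul_le hf
  let K : Set ((F →+* ℝ) → ℝ) := Set.Icc 1 fun _ => c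
  have hKX : ∀ y ∈ K, y ∈ posOrthant F := fun y hy σ => zero_lt_one.trans_le (hy.1 σ)
  choose! C hC hxC using fun x (hx : x ∈ K) => exists_isLocalCone (hKX x hx)
  obtain ⟨t, htK, ht⟩ := (isCompact_Icc : IsCompact K).elim_nhds_subcover C
    fun x hx => (hC x hx).isOpen.mem_nhds (hxC x hx)
  refine ⟨t.card, fun i => C (t.equivFin.symm i), fun i => hC _ (htK _ (Subtype.prop _)),
    fun x hx => ?_⟩
  obtain ⟨ε, hε, hbound⟩ := hc x hx
  obtain ⟨τ, hτ⟩ := Finite.exists_min (unitEmbedding F ε * x)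
  have hτ0 : 0 < (unitEmbedding F ε * x) τ := mul_pos (hε.1 τ) (hx τ)
  have hmem : ((unitEmbedding F ε * x) τ)⁻¹ • (unitEmbedding F ε * x) ∈ K := by
    refine ⟨fun σ => ?_, fun σ => ?_⟩
    · rw [Pi.smul_apply, smul_eq_mul, ← div_eq_inv_mul]
      exact (one_le_div hτ0).2 (hτ σ)
    · rw [Pi.smul_apply, smul_eq_mul, ← div_eq_inv_mul]
      exact (div_le_iff₀ hτ0).2 (hbound σ τ)
  obtain ⟨z, hz, hmemz⟩ := Set.mem_iUnion₂.1 (ht hmem)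
  refine ⟨t.equivFin ⟨z, hz⟩, ε, hε, ?_⟩
  simp only [Equiv.symm_apply_apply]
  exact ((hC z (htK z hz)).smul_mem_iff (inv_pos.2 hτ0)).1 hmemz

theorem embedding_lt_of_mem_nearCone {u : (𝓞 F)ˣ} {x x' y : (F →+* ℝ) → ℝ} (hx : x ∈ posOrthant F)
    (hx' : x' ∈ posOrthant F) (hy : y ∈ nearCone x) (huy : unitEmbedding F u * y ∈ nearCone x') :
    ∃ τ, ∀ σ : F →+* ℝ, σ (u : 𝓞 F) < 2 * (x' σ * x τ / (x' τ * x σ)) := by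
  obtain ⟨τ, hτ⟩ := exists_embedding_unit_le_one u
  refine ⟨τ, fun σ => ?_⟩
  have h1 : 4 * (σ (u : 𝓞 F) * y σ * x' τ) < 5 * (τ (u : 𝓞 F) * y τ * x' σ) := huy.2 σ τ
  have h2 := hy.2 τ σ
  have hyσ := hy.1 σ
  have hyτ := hy.1 τ
  have hxσ := hx σ
  have hxτ := hx τ
  have hxσ' := hx' σ
  have hxτ' := hx' τ
  have h3 : τ (u : 𝓞 F) * (y τ * x' σ) ≤ 1 * (y τ * x' σ) :=
    mul_le_mul_of_nonneg_right hτ (by positivity)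
  have h4 : 4 * (σ (u : 𝓞 F) * y σ * x' τ) < 5 * (y τ * x' σ) := by linarith
  have h5 := mul_lt_mul_of_pos_right h4 hxσ
  have h6 := mul_lt_mul_of_pos_right h2 hxσ'
  rw [← mul_div_assoc, lt_div_iff₀ (by positivity)]
  refine lt_of_mul_lt_mul_right ?_ hyσ.le
  have : 0 < y σ * x τ * x' σ := by positivity
  linarith

theorem IsLocalCone.eq_one_of_mem {f : Ideal (𝓞 F)} {C : Set ((F →+* ℝ) → ℝ)}
    (hC : IsLocalCone C) {u : (𝓞 F)ˣ} (hu : u ∈ congruenceUnits f) {y : (F →+* ℝ) → ℝ}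
    (hy : y ∈ C) (huy : unitEmbedding F u * y ∈ C) : u = 1 := by
  obtain ⟨x, hx, hsub⟩ := hC.exists_subset
  obtain ⟨τ, hτ⟩ := embedding_lt_of_mem_nearCone hx hx (hsub hy) (hsub huy)
  refine unit_eq_one_of_embedding_lt_two fun σ => ⟨hu.1 σ, (hτ σ).trans_eq ?_⟩
  have := (hx σ).ne'
  have := (hx τ).ne'
  field_simp

theorem finite_units_of_embedding_le (R : ℝ) :
    {u : (𝓞 F)ˣ | ∀ σ : F →+* ℝ, |σ (u : 𝓞 F)| ≤ R}.Finite := by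
  have hinj : Function.Injective fun u : (𝓞 F)ˣ => ((u : 𝓞 F) : F) :=
    fun u v h => Units.ext (RingOfIntegers.coe_injective h)
  refine ((Embeddings.finite_of_norm_le F ℂ R).preimage hinj.injOn).subset fun u hu => ?_
  refine ⟨(u : 𝓞 F).isIntegral_coe, fun φ => ?_⟩
  obtain ⟨σ, hσ⟩ := realPlace_bijective.surjective (InfinitePlace.mk φ)
  rw [← InfinitePlace.apply, ← hσ, realPlace_apply]
  exact hu σ

theorem IsLocalCone.finite_units {f : Ideal (𝓞 F)} {C C' : Set ((F →+* ℝ) → ℝ)}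
    (hC : IsLocalCone C) (hC' : IsLocalCone C') :
    {u : (𝓞 F)ˣ | u ∈ congruenceUnits f ∧ ∃ y ∈ C, unitEmbedding F u * y ∈ C'}.Finite := by
  obtain ⟨x, hx, hsub⟩ := hC.exists_subset
  obtain ⟨x', hx', hsub'⟩ := hC'.exists_subset
  have hpos : ∀ σ τ, 0 < x' σ * x τ / (x' τ * x σ) := fun σ τ =>
    div_pos (mul_pos (hx' σ) (hx τ)) (mul_pos (hx' τ) (hx σ))
  refine (finite_units_of_embedding_le
    (2 * ∑ τ, ∑ σ, x' σ * x τ / (x' τ * x σ))).subset ?_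
  rintro u ⟨hu, y, hy, huy⟩ σ
  obtain ⟨τ, hτ⟩ := embedding_lt_of_mem_nearCone hx hx' (hsub hy) (hsub' huy)
  rw [abs_of_pos (hu.1 σ)]
  refine (hτ σ).le.trans (mul_le_mul_of_nonneg_left ?_ zero_le_two)
  refine le_trans ?_ (Finset.single_le_sum
    (fun τ _ => Finset.sum_nonneg fun σ _ => (hpos σ τ).le) (Finset.mem_univ τ))
  exact Finset.single_le_sum (f := fun σ => x' σ * x τ / (x' τ * x σ))
    (fun σ _ => (hpos σ τ).le) (Finset.mem_univ σ)

theorem exists_isConeUnion_fundamentalDomain {f : Ideal (𝓞 F)} (hf : f ≠ ⊥) :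
    ∃ D ⊆ posOrthant F, IsConeUnion (posIntegers F) D ∧
      (∀ x ∈ posOrthant F, ∃ ε ∈ congruenceUnits f, unitEmbedding F ε * x ∈ D) ∧
      ∀ ε ∈ congruenceUnits f, ∀ y ∈ D, unitEmbedding F ε * y ∈ D → ε = 1 := by
  obtain ⟨m, C, hC, hcover⟩ := exists_localCone_cover hf
  let D : Fin m → Set ((F →+* ℝ) → ℝ) := fun i =>
    {y | y ∈ C i ∧ ∀ j < i, ∀ ε ∈ congruenceUnits f, unitEmbedding F ε * y ∉ C j}
  have hD : ∀ i, IsConeUnion (posIntegers F) (D i) := by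
    intro i
    have hfin := fun j => (hC i).finite_units (f := f) (hC j)
    obtain ⟨s, hs, hsC⟩ := (hC i).exists_basis
    have := IsConeUnion.diff_biUnion hs.isConeUnion (Finset.Iio i)
      (fun j => ⋃ ε ∈ (hfin j).toFinset, {y | unitEmbedding F ε * y ∈ C j})
      fun j _ S hS => hS.diff_biUnion _ _ fun ε _ S hS => (hC j).isConeUnion_diff ε hS
    convert this using 1
    rw [hsC]
    ext y
    simp only [D, Set.mem_ofPred_eq, Set.mem_sdiff, Set.mem_iUnion, Set.Finite.mem_toFinset,
      Finset.mem_Iio, not_exists]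
    refine and_congr_right fun hy => forall₂_congr fun j hj => forall_congr' fun ε => ?_
    exact ⟨fun h h1 h2 => h h1.1 h2, fun h h1 h2 => h ⟨h1, y, hy, h2⟩ h2⟩
  have hlt : ∀ i j, j < i → ∀ ε ∈ congruenceUnits f, ∀ y ∈ D i, unitEmbedding F ε * y ∉ D j :=
    fun i j hij ε hε y hy h => hy.2 j hij ε hε h.1
  have hgt : ∀ i j, i < j → ∀ ε ∈ congruenceUnits f, ∀ y ∈ D i, unitEmbedding F ε * y ∉ D j := by
    intro i j hij ε hε y hy h
    refine h.2 i hij ε⁻¹ (inv_mem hε) ?_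
    rw [unitEmbedding_inv_mul_cancel]
    exact hy.1
  refine ⟨⋃ i ∈ Finset.univ, D i, ?_, IsConeUnion.biUnion _ _ (fun i _ => hD i) ?_, ?_, ?_⟩
  · intro y hy
    simp only [Set.mem_iUnion] at hy
    obtain ⟨i, -, hy⟩ := hy
    obtain ⟨x, -, hsub⟩ := (hC i).exists_subset
    exact (hsub hy.1).1
  · intro i _ j _ hij
    rw [Function.onFun, Set.disjoint_left]
    intro y hi hj
    have h1 : unitEmbedding F 1 * y ∈ D j := by rwa [map_one, one_mul]
    rcases lt_or_gt_of_ne hij with h | h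
    · exact hgt i j h 1 (one_mem _) y hi h1
    · exact hlt i j h 1 (one_mem _) y hi h1
  · intro x hx
    obtain ⟨i, ⟨ε, hε, hi⟩, hmin⟩ := wellFounded_lt.has_min
      {i | ∃ ε ∈ congruenceUnits f, unitEmbedding F ε * x ∈ C i} (hcover x hx)
    refine ⟨ε, hε, Set.mem_biUnion (Finset.mem_univ i) ⟨hi, fun j hj ε' hε' h => ?_⟩⟩
    refine hmin j ⟨ε' * ε, mul_mem hε' hε, ?_⟩ hj
    rwa [map_mul, mul_assoc]
  · intro ε hε y hy hεy
    simp only [Set.mem_iUnion, Finset.mem_univ, exists_const] at hy hεy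
    obtain ⟨i, hi⟩ := hy
    obtain ⟨j, hj⟩ := hεy
    rcases lt_trichotomy i j with h | rfl | h
    · exact (hgt i j h ε hε y hi hj).elim
    · exact (hC i).eq_one_of_mem hε hi.1 hj.1
    · exact (hlt i j h ε hε y hi hj).elim

end FundamentalDomain

theorem IsTotallyRealField.isTotallyReal {F : Type*} [Field F] (h : IsTotallyRealField F) :
    IsTotallyReal F where
  isReal _ := InfinitePlace.isReal_iff.2 <| ComplexEmbedding.isReal_iff.2 <| RingHom.ext fun x =>
    Complex.conj_eq_iff_im.2 (h _ x)

theorem IsConeBasis.exists_generators {F : Type*} [Field F] {s : Finset ((F →+* ℝ) → ℝ)}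
    (hs : IsConeBasis (posIntegers F) s) : ∃ v : Fin s.card → 𝓞 F,
      (∀ i, ∀ σ : F →+* ℝ, 0 < σ ((v i : 𝓞 F) : F)) ∧
      (LinearIndependent ℝ fun i (σ : F →+* ℝ) => σ ((v i : 𝓞 F) : F)) ∧
      simplicialCone (fun i => ((v i : 𝓞 F) : F)) = openCone s := by
  classical
  choose v hpos hv using fun i => hs.1 (s.equivFin.symm i).2
  have hv' : (fun i (σ : F →+* ℝ) => σ ((v i : 𝓞 F) : F)) =
      fun i => (s.equivFin.symm i : (F →+* ℝ) → ℝ) := funext fun i => (hv i).symm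
  have hli : LinearIndependent ℝ fun i (σ : F →+* ℝ) => σ ((v i : 𝓞 F) : F) := by
    rw [hv']
    exact LinearIndependent.comp hs.2 _ s.equivFin.symm.injective
  refine ⟨v, hpos, hli, ?_⟩
  have himage : s = Finset.univ.image fun i (σ : F →+* ℝ) => σ ((v i : 𝓞 F) : F) := by
    rw [hv']
    ext y
    simp only [Finset.mem_image, Finset.mem_univ, true_and]
    exact ⟨fun h => ⟨s.equivFin ⟨y, h⟩, by simp⟩, fun ⟨i, hi⟩ => hi ▸ Subtype.prop _⟩
  conv_rhs => rw [himage, openCone_image hli.injective]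
  ext y
  simp only [simplicialCone, Set.mem_ofPred_eq, funext_iff, Finset.sum_apply, Pi.smul_apply,
    smul_eq_mul]

/-- **Existence of Shintani domains.** For a totally real field `F` and a
nonzero integral ideal `f`, there are finitely many open simplicial cones, with totally
positive generators in `𝒪_F` and ℝ-linearly independent generating tuples, which are
pairwise disjoint and whose union `D` is a fundamental domain for the multiplication
action of `E_{f,+}` on the totally positive orthant. -/
theorem exists_shintani_domain (F : Type*) [Field F] [NumberField F]
    (htr : IsTotallyRealField F) (f : Ideal (𝓞 F)) (hf : f ≠ ⊥) :
    ∃ (N : ℕ) (ρ : Fin N → ℕ) (v : (j : Fin N) → Fin (ρ j) → 𝓞 F) (D : Set ((F →+* ℝ) → ℝ)),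
      D = ⋃ j : Fin N, simplicialCone (fun i => ((v j i : 𝓞 F) : F)) ∧
      (∀ j i, ∀ σ : F →+* ℝ, 0 < σ ((v j i : 𝓞 F) : F)) ∧
      (∀ j, LinearIndependent ℝ (fun i (σ : F →+* ℝ) => σ ((v j i : 𝓞 F) : F))) ∧
      (∀ j j' : Fin N, j ≠ j' →
        simplicialCone (fun i => ((v j i : 𝓞 F) : F)) ∩
          simplicialCone (fun i => ((v j' i : 𝓞 F) : F)) = ∅) ∧
      (∀ ε ε' : (𝓞 F)ˣ, memEfPlus f ε → memEfPlus f ε' → ε ≠ ε' →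
        fieldScale (((ε : 𝓞 F) : F)) D ∩ fieldScale (((ε' : 𝓞 F) : F)) D = ∅) ∧
      (⋃ ε : {ε : (𝓞 F)ˣ // memEfPlus f ε},
        fieldScale ((((ε : (𝓞 F)ˣ) : 𝓞 F) : F)) D) = posOrthant F := by
  have := htr.isTotallyReal
  obtain ⟨D, hDX, ⟨T, hT, hd, hTD⟩, hcover, hone⟩ := exists_isConeUnion_fundamentalDomain hf
  have hex : ∀ j : Fin T.card, ∃ v : Fin (T.equivFin.symm j : Finset ((F →+* ℝ) → ℝ)).card → 𝓞 F,
      (∀ i, ∀ σ : F →+* ℝ, 0 < σ ((v i : 𝓞 F) : F)) ∧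
      (LinearIndependent ℝ fun i (σ : F →+* ℝ) => σ ((v i : 𝓞 F) : F)) ∧
      simplicialCone (fun i => ((v i : 𝓞 F) : F)) = openCone (T.equivFin.symm j : Finset _) :=
    fun j => (hT _ (T.equivFin.symm j).2).exists_generators
  choose v hpos hli hcone using hex
  refine ⟨T.card, _, v, D, ?_, hpos, hli, fun j j' hj => ?_, fun ε ε' hε hε' hne => ?_, ?_⟩
  · simp only [hcone]
    rw [← hTD]
    refine (Set.biUnion_eq_iUnion (T : Set (Finset ((F →+* ℝ) → ℝ))) fun t _ => openCone t).trans ?_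
    exact (T.equivFin.symm.surjective.iUnion_comp
      fun t : T => openCone (t : Finset ((F →+* ℝ) → ℝ))).symm
  · rw [hcone, hcone, ← Set.disjoint_iff_inter_eq_empty]
    exact hd (Subtype.prop _) (Subtype.prop _) fun h =>
      hj (T.equivFin.symm.injective (Subtype.ext h))
  · rw [Set.eq_empty_iff_forall_notMem]
    rintro _ ⟨⟨y, hy, rfl⟩, ⟨z, hz, h⟩⟩
    have h : unitEmbedding F ε' * z = unitEmbedding F ε * y := h
    have hyz : unitEmbedding F (ε'⁻¹ * ε) * y = z := by
      rw [map_mul, mul_assoc, ← h, unitEmbedding_inv_mul_cancel]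
    have := hone (ε'⁻¹ * ε)
      ((congruenceUnits f).mul_mem ((congruenceUnits f).inv_mem hε') hε) y hy (hyz ▸ hz)
    exact hne (inv_mul_eq_one.1 this).symm
  · refine Set.Subset.antisymm (Set.iUnion_subset ?_) fun x hx => ?_
    · rintro ⟨ε, hε⟩ _ ⟨y, hy, rfl⟩ σ
      exact mul_pos (hε.1 σ) (hDX hy σ)
    · obtain ⟨ε, hε, hx⟩ := hcover x hx
      refine Set.mem_iUnion.2 ⟨⟨ε⁻¹, (congruenceUnits f).inv_mem hε⟩, _, hx, ?_⟩
      exact unitEmbedding_inv_mul_cancel ε x
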